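/- arXiv:2102.02095 — 2 statements merged into one kernel-verified Lean document; each statement's English description precedes it below -/
import Mathlib

section
/- Let β > 0 and α, δ, r ∈ ℝ, L > 0. There exists a function G : ℝ² → ℂ which is infinitely differentiable on an open set containing the closed triangle Δ̄' and satisfies the integral equation G(s,t) = (r/(3β)) s t + (P G)(s,t) for every (s,t) ∈ Δ̄'. -/
noncomputable section

open MeasureTheory

/-- Partial derivative in the first variable. -/
def pd1 (f : ℝ → ℝ → ℂ) : ℝ → ℝ → ℂ := fun x y => deriv (fun x' => f x' y) x

/-- Partial derivative in the second variable. -/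
def pd2 (f : ℝ → ℝ → ℂ) : ℝ → ℝ → ℂ := fun x y => deriv (fun y' => f x y') y

/-- The closed triangle Δ̄' = {(s,t) : s ≥ 0, t ≥ 0, s + t ≤ L}. -/
def TriP (L : ℝ) : Set (ℝ × ℝ) := {p | 0 ≤ p.1 ∧ 0 ≤ p.2 ∧ p.1 + p.2 ≤ L}

/-- The differential operator `D` from the kernel integral equation. -/
def Dop (β α δ r : ℝ) (f : ℝ → ℝ → ℂ) : ℝ → ℝ → ℂ := fun s t =>
  (1 / (3 * (β : ℂ))) *
    ((β : ℂ) * (3 * pd1 (pd2 (pd2 f)) s t - pd2 (pd2 (pd2 f)) s t)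
      - Complex.I * (α : ℂ) * (pd2 (pd2 f) s t - 2 * pd1 (pd2 f) s t)
      - (δ : ℂ) * pd2 f s t - (r : ℂ) * f s t)

/-- The integral operator `P` from the kernel integral equation. -/
def Pop (β α δ r : ℝ) (f : ℝ → ℝ → ℂ) : ℝ → ℝ → ℂ := fun s t =>
  ∫ η in (0:ℝ)..t, ∫ ω in (0:ℝ)..s, ∫ ξ in (0:ℝ)..ω, Dop β α δ r f ξ η

section ExponentialOrbit

variable {E : Type*} [NormedAddCommGroup E] [NormedSpace ℂ E]

/-- The scalar function `(s, t) ↦ ℓ (exp (s A) (exp (t B) x))`. -/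
def expOrbit (ℓ : E →L[ℂ] ℂ) (A B : E →L[ℂ] E) (x : E) (s t : ℝ) : ℂ :=
  ℓ (NormedSpace.exp ((s : ℂ) • A) (NormedSpace.exp ((t : ℂ) • B) x))

variable (ℓ : E →L[ℂ] ℂ) (A B : E →L[ℂ] E)

theorem expOrbit_add (x y : E) (s t : ℝ) :
    expOrbit ℓ A B (x + y) s t = expOrbit ℓ A B x s t + expOrbit ℓ A B y s t := by
  simp [expOrbit]

theorem expOrbit_sub (x y : E) (s t : ℝ) :
    expOrbit ℓ A B (x - y) s t = expOrbit ℓ A B x s t - expOrbit ℓ A B y s t := by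
  simp [expOrbit]

theorem expOrbit_smul (a : ℂ) (x : E) (s t : ℝ) :
    expOrbit ℓ A B (a • x) s t = a * expOrbit ℓ A B x s t := by
  simp [expOrbit]

variable [CompleteSpace E]

theorem hasDerivAt_exp_ofReal_smul_apply (x : E) (m : E →L[ℂ] ℂ) (s : ℝ) :
    HasDerivAt (fun s : ℝ => m (NormedSpace.exp ((s : ℂ) • A) x))
      (m (NormedSpace.exp ((s : ℂ) • A) (A x))) s :=
  HasDerivAt.comp_ofReal (e := fun z => m (NormedSpace.exp (z • A) x)) <|
    (m.comp (ContinuousLinearMap.apply ℂ E x)).hasFDerivAt.comp_hasDerivAt (s : ℂ)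
      (hasDerivAt_exp_smul_const A (s : ℂ))

theorem hasSum_exp_smul_apply (x : E) (m : E →L[ℂ] ℂ) (z : ℂ) :
    HasSum (fun n : ℕ => (n.factorial : ℂ)⁻¹ * z ^ n * m ((A ^ n) x))
      (m (NormedSpace.exp (z • A) x)) := by
  have h := (NormedSpace.exp_series_hasSum_exp' (𝕂 := ℂ) (z • A)).mapL
    (m.comp (ContinuousLinearMap.apply ℂ E x))
  simpa [smul_pow, mul_assoc] using h

theorem hasDerivAt_expOrbit_snd (x : E) (s t : ℝ) :
    HasDerivAt (fun t => expOrbit ℓ A B x s t) (expOrbit ℓ A B (B x) s t) t :=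
  hasDerivAt_exp_ofReal_smul_apply B x (ℓ.comp (NormedSpace.exp ((s : ℂ) • A))) t

theorem contDiff_expOrbit (x : E) {n : WithTop ℕ∞} :
    ContDiff ℝ n (Function.uncurry (expOrbit ℓ A B x)) := by
  have hexp : ContDiff ℂ n (NormedSpace.exp : (E →L[ℂ] E) → (E →L[ℂ] E)) :=
    AnalyticOnNhd.contDiff fun y _ => NormedSpace.exp_analytic y
  have hA : ContDiff ℂ n (fun z : ℂ × ℂ => NormedSpace.exp (z.1 • A)) :=
    hexp.comp (contDiff_fst.smul contDiff_const)
  have hB : ContDiff ℂ n (fun z : ℂ × ℂ => NormedSpace.exp (z.2 • B)) :=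
    hexp.comp (contDiff_snd.smul contDiff_const)
  have h : ContDiff ℂ n (fun z : ℂ × ℂ =>
      ℓ (NormedSpace.exp (z.1 • A) (NormedSpace.exp (z.2 • B) x))) :=
    ℓ.contDiff.comp (hA.clm_apply (hB.clm_apply contDiff_const))
  exact (h.restrict_scalars ℝ).comp
    ((Complex.ofRealCLM.contDiff.comp contDiff_fst).prodMk
      (Complex.ofRealCLM.contDiff.comp contDiff_snd))

theorem continuous_expOrbit_fst (x : E) (t : ℝ) :
    Continuous (fun s => expOrbit ℓ A B x s t) :=
  (contDiff_expOrbit ℓ A B x (n := 0)).continuous.comp (by fun_prop : Continuous fun s => (s, t))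

theorem continuous_expOrbit_snd (x : E) (s : ℝ) :
    Continuous (fun t => expOrbit ℓ A B x s t) :=
  (contDiff_expOrbit ℓ A B x (n := 0)).continuous.comp (by fun_prop : Continuous fun t => (s, t))

theorem pd2_expOrbit (x : E) : pd2 (expOrbit ℓ A B x) = expOrbit ℓ A B (B x) := by
  ext s t
  exact (hasDerivAt_expOrbit_snd ℓ A B x s t).deriv

variable {A B}

theorem hasDerivAt_expOrbit_fst (hAB : Commute A B) (x : E) (s t : ℝ) :
    HasDerivAt (fun s => expOrbit ℓ A B x s t) (expOrbit ℓ A B (A x) s t) s := by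
  have h := hasDerivAt_exp_ofReal_smul_apply A (NormedSpace.exp ((t : ℂ) • B) x) ℓ s
  have hc : Commute A (NormedSpace.exp ((t : ℂ) • B)) := (hAB.smul_right (t : ℂ)).exp_right
  have hx : A (NormedSpace.exp ((t : ℂ) • B) x) = NormedSpace.exp ((t : ℂ) • B) (A x) :=
    DFunLike.congr_fun hc.eq x
  rwa [hx] at h

theorem pd1_expOrbit (hAB : Commute A B) (x : E) :
    pd1 (expOrbit ℓ A B x) = expOrbit ℓ A B (A x) := by
  ext s t
  exact (hasDerivAt_expOrbit_fst ℓ hAB x s t).deriv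

theorem integral_expOrbit_fst (hAB : Commute A B) (x : E) (s t : ℝ) :
    ∫ ξ in (0:ℝ)..s, expOrbit ℓ A B (A x) ξ t = expOrbit ℓ A B x s t - expOrbit ℓ A B x 0 t :=
  intervalIntegral.integral_eq_sub_of_hasDerivAt
    (fun ξ _ => hasDerivAt_expOrbit_fst ℓ hAB x ξ t)
    ((continuous_expOrbit_fst ℓ A B (A x) t).intervalIntegrable _ _)

variable (A B)

theorem integral_expOrbit_snd (x : E) (s t : ℝ) :
    ∫ η in (0:ℝ)..t, expOrbit ℓ A B (B x) s η = expOrbit ℓ A B x s t - expOrbit ℓ A B x s 0 :=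
  intervalIntegral.integral_eq_sub_of_hasDerivAt
    (fun η _ => hasDerivAt_expOrbit_snd ℓ A B x s η)
    ((continuous_expOrbit_snd ℓ A B (B x) s).intervalIntegrable _ _)

theorem expOrbit_zero_fst_of_pow_apply_eq_zero {x : E} (h : ∀ n, n ≠ 0 → ℓ ((B ^ n) x) = 0)
    (t : ℝ) : expOrbit ℓ A B x 0 t = ℓ x := by
  have hs := hasSum_exp_smul_apply B x ℓ (t : ℂ)
  have h0 := hasSum_single (f := fun n : ℕ => (n.factorial : ℂ)⁻¹ * (t : ℂ) ^ n * ℓ ((B ^ n) x)) 0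
    (fun n hn => by rw [h n hn, mul_zero])
  simpa [expOrbit] using hs.unique h0

theorem expOrbit_zero_snd_of_pow_apply_eq_zero {x : E} (h : ∀ n, ℓ ((A ^ n) x) = 0)
    (s : ℝ) : expOrbit ℓ A B x s 0 = 0 := by
  have hs := hasSum_exp_smul_apply A x ℓ (s : ℂ)
  simp only [h, mul_zero] at hs
  simpa [expOrbit] using hs.unique hasSum_zero

end ExponentialOrbit

section Shift

open BoundedContinuousFunction

/-- The operator `f ↦ f ∘ g` on bounded functions on `ℕ × ℕ`. -/
def bddComp (g : ℕ × ℕ → ℕ × ℕ) : ((ℕ × ℕ) →ᵇ ℂ) →L[ℂ] ((ℕ × ℕ) →ᵇ ℂ) :=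
  LinearMap.mkContinuous
    { toFun := fun f => f.compContinuous ⟨g, continuous_of_discreteTopology⟩
      map_add' := fun _ _ => rfl
      map_smul' := fun _ _ => rfl } 1 fun f => by
    rw [one_mul]
    exact (BoundedContinuousFunction.norm_le (norm_nonneg f)).2 fun p => f.norm_coe_le_norm (g p)

@[simp]
theorem bddComp_apply (g : ℕ × ℕ → ℕ × ℕ) (f : (ℕ × ℕ) →ᵇ ℂ) (p : ℕ × ℕ) :
    bddComp g f p = f (g p) := rfl

/-- The shift in the first index, scaled by `M`. -/
def shift1 (M : ℂ) : ((ℕ × ℕ) →ᵇ ℂ) →L[ℂ] ((ℕ × ℕ) →ᵇ ℂ) :=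
  M • bddComp fun p => (p.1 + 1, p.2)

/-- The shift in the second index. -/
def shift2 : ((ℕ × ℕ) →ᵇ ℂ) →L[ℂ] ((ℕ × ℕ) →ᵇ ℂ) :=
  bddComp fun p => (p.1, p.2 + 1)

@[simp]
theorem shift1_apply (M : ℂ) (f : (ℕ × ℕ) →ᵇ ℂ) (k j : ℕ) :
    shift1 M f (k, j) = M * f (k + 1, j) := rfl

@[simp]
theorem shift2_apply (f : (ℕ × ℕ) →ᵇ ℂ) (k j : ℕ) : shift2 f (k, j) = f (k, j + 1) := rfl

theorem commute_shift (M : ℂ) : Commute (shift1 M) shift2 := by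
  refine ContinuousLinearMap.ext fun f => ?_
  ext ⟨k, j⟩
  rfl

theorem shift1_pow_apply (M : ℂ) (f : (ℕ × ℕ) →ᵇ ℂ) (n k j : ℕ) :
    (shift1 M ^ n) f (k, j) = M ^ n * f (k + n, j) := by
  induction n generalizing k with
  | zero => simp
  | succ n ih =>
    rw [pow_succ', mul_apply_eq_comp, shift1_apply, ih, add_right_comm, pow_succ',
      mul_assoc, add_assoc]

theorem shift2_pow_apply (f : (ℕ × ℕ) →ᵇ ℂ) (n k j : ℕ) :
    (shift2 ^ n) f (k, j) = f (k, j + n) := by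
  induction n generalizing j with
  | zero => simp
  | succ n ih =>
    rw [pow_succ', mul_apply_eq_comp, shift2_apply, ih, add_right_comm, add_assoc]

end Shift

section Coefficients

open BoundedContinuousFunction

/-- The Taylor coefficients `∂ₛᵏ ∂ₜʲ G (0, 0) / Mᵏ` of the solution `G` of
`G_sst = G_stt - G_ttt / 3 + a (G_tt - 2 G_st) + d G_t + ρ G` with `G (s, 0) = G (0, t) = 0` and
`G_s (0, t) = c t`. -/
def kernelCoeff (c a d ρ : ℂ) (M : ℝ) : ℕ → ℕ → ℂ
  | 0 => 0
  | 1 => Pi.single 1 (c / M)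
  | k + 2 => fun
    | 0 => 0
    | j + 1 => ((M : ℂ) ^ 2)⁻¹ *
        (M * kernelCoeff c a d ρ M (k + 1) (j + 2) - kernelCoeff c a d ρ M k (j + 3) / 3
          + a * (kernelCoeff c a d ρ M k (j + 2) - 2 * (M * kernelCoeff c a d ρ M (k + 1) (j + 1)))
          + d * kernelCoeff c a d ρ M k (j + 1) + ρ * kernelCoeff c a d ρ M k j)

variable (c a d ρ : ℂ) {M : ℝ}

theorem kernelCoeff_zero_right (M : ℝ) (k : ℕ) : kernelCoeff c a d ρ M k 0 = 0 := by
  match k with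
  | 0 => rfl
  | 1 => simp [kernelCoeff]
  | k + 2 => rfl

theorem norm_kernelCoeff_le (hM : 2 + 3 * ‖a‖ + ‖d‖ + ‖ρ‖ ≤ M) (k j : ℕ) :
    ‖kernelCoeff c a d ρ M k j‖ ≤ ‖c / M‖ := by
  have hM2 : 2 ≤ M := by linarith [norm_nonneg a, norm_nonneg d, norm_nonneg ρ]
  induction k using Nat.strong_induction_on generalizing j with
  | _ k ih =>
  match k, j with
  | 0, j =>
    rw [kernelCoeff, Pi.zero_apply, norm_zero]
    exact norm_nonneg _
  | 1, j =>
    rw [kernelCoeff, Pi.single_apply]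
    split_ifs
    · exact le_rfl
    · rw [norm_zero]
      exact norm_nonneg _
  | k + 2, 0 =>
    rw [kernelCoeff_zero_right, norm_zero]
    exact norm_nonneg _
  | k + 2, j + 1 =>
    have h1 := ih (k + 1) (by omega)
    have h0 := ih k (by omega)
    set C := ‖c / M‖
    have hC : 0 ≤ C := norm_nonneg _
    have hMn : ‖(M : ℂ)‖ = M := by
      rw [Complex.norm_real, Real.norm_of_nonneg (by linarith)]
    rw [kernelCoeff, norm_mul, norm_inv, norm_pow, hMn, inv_mul_le_iff₀ (by positivity)]
    have e1 : ‖(M : ℂ) * kernelCoeff c a d ρ M (k + 1) (j + 2)‖ ≤ M * C := by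
      rw [norm_mul, hMn]; gcongr; exact h1 _
    have e2 : ‖kernelCoeff c a d ρ M k (j + 3) / 3‖ ≤ C := by
      rw [norm_div]; norm_num; linarith [h0 (j + 3)]
    have e3 : ‖a * (kernelCoeff c a d ρ M k (j + 2)
        - 2 * (M * kernelCoeff c a d ρ M (k + 1) (j + 1)))‖ ≤ ‖a‖ * (C + 2 * (M * C)) := by
      rw [norm_mul]; gcongr
      refine (norm_sub_le _ _).trans ?_
      gcongr
      · exact h0 _
      · rw [norm_mul, norm_mul, hMn]; norm_num; gcongr; exact h1 _
    have e4 : ‖d * kernelCoeff c a d ρ M k (j + 1)‖ ≤ ‖d‖ * C := by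
      rw [norm_mul]; gcongr; exact h0 _
    have e5 : ‖ρ * kernelCoeff c a d ρ M k j‖ ≤ ‖ρ‖ * C := by
      rw [norm_mul]; gcongr; exact h0 _
    refine (norm_add_le_of_le (norm_add_le_of_le (norm_add_le_of_le (norm_sub_le_of_le e1 e2) e3)
      e4) e5).trans ?_
    have hfac : M + 1 + ‖a‖ * (1 + 2 * M) + ‖d‖ + ‖ρ‖ ≤ M ^ 2 := by
      nlinarith [norm_nonneg a, norm_nonneg d, norm_nonneg ρ,
        mul_le_mul_of_nonneg_left hM (by linarith : 0 ≤ M),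
        mul_le_mul_of_nonneg_left hM2 (norm_nonneg a),
        mul_le_mul_of_nonneg_left hM2 (norm_nonneg d),
        mul_le_mul_of_nonneg_left hM2 (norm_nonneg ρ)]
    calc M * C + C + ‖a‖ * (C + 2 * (M * C)) + ‖d‖ * C + ‖ρ‖ * C
        = (M + 1 + ‖a‖ * (1 + 2 * M) + ‖d‖ + ‖ρ‖) * C := by ring
      _ ≤ M ^ 2 * C := by gcongr

/-- The coefficients `kernelCoeff` as a bounded function on `ℕ × ℕ`. -/
def kernelCoeffBdd (hM : 2 + 3 * ‖a‖ + ‖d‖ + ‖ρ‖ ≤ M) : (ℕ × ℕ) →ᵇ ℂ :=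
  BoundedContinuousFunction.ofNormedAddCommGroup (fun p => kernelCoeff c a d ρ M p.1 p.2)
    continuous_of_discreteTopology ‖c / M‖ fun p => norm_kernelCoeff_le c a d ρ hM p.1 p.2

@[simp]
theorem kernelCoeffBdd_apply (hM : 2 + 3 * ‖a‖ + ‖d‖ + ‖ρ‖ ≤ M) (k j : ℕ) :
    kernelCoeffBdd c a d ρ hM (k, j) = kernelCoeff c a d ρ M k j := rfl

theorem shift_kernelCoeffBdd (hM : 2 + 3 * ‖a‖ + ‖d‖ + ‖ρ‖ ≤ M) (x : (ℕ × ℕ) →ᵇ ℂ)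
    (hx : x = kernelCoeffBdd c a d ρ hM) :
    shift1 M (shift1 M (shift2 x)) =
      shift1 M (shift2 (shift2 x)) - (1 / 3 : ℂ) • shift2 (shift2 (shift2 x))
        + a • (shift2 (shift2 x) - (2 : ℂ) • shift1 M (shift2 x)) + d • shift2 x + ρ • x := by
  have hM0 : (M : ℂ) ≠ 0 := by
    have : 0 < M := by linarith [norm_nonneg a, norm_nonneg d, norm_nonneg ρ]
    exact_mod_cast this.ne'
  subst hx
  ext ⟨k, j⟩
  simp only [shift1_apply, shift2_apply, kernelCoeffBdd_apply, BoundedContinuousFunction.add_apply,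
    BoundedContinuousFunction.sub_apply, BoundedContinuousFunction.smul_apply, smul_eq_mul]
  rw [kernelCoeff]
  field_simp

end Coefficients

theorem stmt2 (β α δ r L : ℝ) (hβ : 0 < β) (hL : 0 < L) :
    ∃ G : ℝ → ℝ → ℂ,
      (∃ U : Set (ℝ × ℝ), IsOpen U ∧ TriP L ⊆ U ∧
        ContDiffOn ℝ (⊤ : ℕ∞) (Function.uncurry G) U) ∧
      ∀ p ∈ TriP L,
        G p.1 p.2 = ((r / (3 * β) : ℝ) : ℂ) * (p.1 : ℂ) * (p.2 : ℂ)
          + Pop β α δ r G p.1 p.2 := by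
  set c : ℂ := ((r / (3 * β) : ℝ) : ℂ)
  set a : ℂ := -(Complex.I * α / (3 * β)) with ha
  set d : ℂ := -(δ / (3 * β) : ℂ) with hd
  set ρ : ℂ := -(r / (3 * β) : ℂ) with hρ
  set M : ℝ := 2 + 3 * ‖a‖ + ‖d‖ + ‖ρ‖ with hM
  have hβ0 : (β : ℂ) ≠ 0 := by exact_mod_cast hβ.ne'
  have hM0 : (M : ℂ) ≠ 0 := by
    have : 0 < M := by positivity
    exact_mod_cast this.ne'
  set x := kernelCoeffBdd c a d ρ hM.ge with hx
  have hcomm := commute_shift (M : ℂ)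
  set A := shift1 (M : ℂ) with hA
  set B := shift2 with hB
  let ℓ := BoundedContinuousFunction.evalCLM ℂ (β := ℂ) ((0, 0) : ℕ × ℕ)
  have hℓ : ∀ y, ℓ y = y (0, 0) := fun _ => rfl
  have hD : Dop β α δ r (expOrbit ℓ A B x) = expOrbit ℓ A B (A (A (B x))) := by
    ext s t
    rw [shift_kernelCoeffBdd c a d ρ hM.ge x hx]
    simp only [Dop, pd2_expOrbit, pd1_expOrbit ℓ hcomm, expOrbit_add, expOrbit_sub, expOrbit_smul]
    rw [ha, hd, hρ]
    field_simp
    ring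
  have hG0 : ∀ s, expOrbit ℓ A B x s 0 = 0 :=
    expOrbit_zero_snd_of_pow_apply_eq_zero ℓ A B fun n => by
      rw [hℓ, hA, shift1_pow_apply, hx, kernelCoeffBdd_apply, kernelCoeff_zero_right, mul_zero]
  have hGt : ∀ t, expOrbit ℓ A B (B x) 0 t = 0 := fun t => by
    rw [expOrbit_zero_fst_of_pow_apply_eq_zero ℓ A B (fun n _ => by
      rw [hℓ, hB, shift2_pow_apply]; simp [hx, kernelCoeff])]
    simp [hℓ, hB, hx, kernelCoeff]
  have hGst : ∀ t, expOrbit ℓ A B (A (B x)) 0 t = c := fun t => by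
    rw [expOrbit_zero_fst_of_pow_apply_eq_zero ℓ A B (fun n hn => by
      rw [hℓ, hA, hB, shift2_pow_apply]; simp [hx, kernelCoeff, hn])]
    simp [hℓ, hA, hB, hx, kernelCoeff]
    field_simp
  refine ⟨expOrbit ℓ A B x, ⟨Set.univ, isOpen_univ, Set.subset_univ _,
    (contDiff_expOrbit ℓ A B x).contDiffOn⟩, fun p _ => ?_⟩
  have hω : ∀ s η : ℝ, ∫ ω in (0:ℝ)..s, (expOrbit ℓ A B (A (B x)) ω η - c) =
      expOrbit ℓ A B (B x) s η - s * c := fun s η => by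
    rw [intervalIntegral.integral_sub
      ((continuous_expOrbit_fst ℓ A B _ η).intervalIntegrable _ _) intervalIntegrable_const,
      integral_expOrbit_fst ℓ hcomm, hGt, intervalIntegral.integral_const]
    simp
  simp only [Pop, hD, integral_expOrbit_fst ℓ hcomm, hGst, hω]
  rw [intervalIntegral.integral_sub
    ((continuous_expOrbit_snd ℓ A B _ p.1).intervalIntegrable _ _) intervalIntegrable_const,
    integral_expOrbit_snd, hG0, intervalIntegral.integral_const]
  simp
  ring
end
end

section
/- Let β > 0, α, δ ∈ ℝ, r ∈ ℝ, L > 0, T > 0, and let p be an observer backstepping kernel with parameter r. Suppose w̃ : [0,L]×[0,T] → ℂ is smooth, satisfies i w̃_t + iβ w̃_{xxx} + α w̃_{xx} + iδ w̃_x + i r w̃ = 0 on (0,L)×(0,T), and w̃(0,t) = 0 for all t ∈ [0,T]. Define ũ(x,t) := w̃(x,t) − ∫₀ˣ p(x,y) w̃(y,t) dy, and set p₁(x) := −iβ p_y(x,0) + α p(x,0) and p₂(x) := iβ p(x,0). Then for all (x,t) ∈ [0,L]×[0,T]: i ũ_t + iβ ũ_{xxx} + α ũ_{xx} + iδ ũ_x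 + p₁(x) ũ_x(0,t) + p₂(x) ũ_{xx}(0,t) = 0; moreover ũ(0,t) = 0, ũ_x(0,t) = w̃_x(0,t) and ũ_{xx}(0,t) = w̃_{xx}(0,t) for all t, and ũ(L,t) = w̃(L,t). -/
noncomputable section

open MeasureTheory

/-- The closed triangle Δ̄ = {(x,y) : 0 ≤ y ≤ x ≤ L}. -/
def Tri (L : ℝ) : Set (ℝ × ℝ) := {p | 0 ≤ p.2 ∧ p.2 ≤ p.1 ∧ p.1 ≤ L}

/-- Observer backstepping kernel with parameter `r`. -/
def IsObsKernel (β α δ r L : ℝ) (p : ℝ → ℝ → ℂ) : Prop :=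
  (∃ U : Set (ℝ × ℝ), IsOpen U ∧ Tri L ⊆ U ∧ ContDiffOn ℝ 3 (Function.uncurry p) U) ∧
  (∀ q ∈ Tri L,
    (β : ℂ) * (pd1 (pd1 (pd1 p)) q.1 q.2 + pd2 (pd2 (pd2 p)) q.1 q.2)
      - Complex.I * (α : ℂ) * (pd1 (pd1 p) q.1 q.2 - pd2 (pd2 p) q.1 q.2)
      + (δ : ℂ) * (pd1 p q.1 q.2 + pd2 p q.1 q.2) - (r : ℂ) * p q.1 q.2 = 0) ∧
  (∀ x ∈ Set.Icc (0:ℝ) L, p x x = 0) ∧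
  (∀ y ∈ Set.Icc (0:ℝ) L, p L y = 0) ∧
  (∀ x ∈ Set.Icc (0:ℝ) L, pd1 p x x = ((r * (L - x) / (3 * β) : ℝ) : ℂ))

open Function Filter Topology Set

theorem hasFDerivAt_uncurry {f : ℝ → ℝ → ℂ} {n : WithTop ℕ∞} (hf : ContDiff ℝ n (uncurry f))
    (hn : n ≠ 0) (x y : ℝ) :
    HasFDerivAt (uncurry f) (fderiv ℝ (uncurry f) (x, y)) (x, y) :=
  (hf.differentiable hn (x, y)).hasFDerivAt

theorem hasDerivAt_fst_fderiv {f : ℝ → ℝ → ℂ} {n : WithTop ℕ∞} (hf : ContDiff ℝ n (uncurry f))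
    (hn : n ≠ 0) (x y : ℝ) :
    HasDerivAt (fun x' => f x' y) (fderiv ℝ (uncurry f) (x, y) (1, 0)) x :=
  (hasFDerivAt_uncurry hf hn x y).comp_hasDerivAt (f := fun s => (s, y)) x
    ((hasDerivAt_id x).prodMk (hasDerivAt_const x y))

theorem hasDerivAt_snd_fderiv {f : ℝ → ℝ → ℂ} {n : WithTop ℕ∞} (hf : ContDiff ℝ n (uncurry f))
    (hn : n ≠ 0) (x y : ℝ) :
    HasDerivAt (fun y' => f x y') (fderiv ℝ (uncurry f) (x, y) (0, 1)) y :=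
  (hasFDerivAt_uncurry hf hn x y).comp_hasDerivAt (f := fun s => (x, s)) y
    ((hasDerivAt_const y x).prodMk (hasDerivAt_id y))

theorem pd1_eq_fderiv {f : ℝ → ℝ → ℂ} {n : WithTop ℕ∞} (hf : ContDiff ℝ n (uncurry f))
    (hn : n ≠ 0) (x y : ℝ) : pd1 f x y = fderiv ℝ (uncurry f) (x, y) (1, 0) :=
  (hasDerivAt_fst_fderiv hf hn x y).deriv

theorem pd2_eq_fderiv {f : ℝ → ℝ → ℂ} {n : WithTop ℕ∞} (hf : ContDiff ℝ n (uncurry f))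
    (hn : n ≠ 0) (x y : ℝ) : pd2 f x y = fderiv ℝ (uncurry f) (x, y) (0, 1) :=
  (hasDerivAt_snd_fderiv hf hn x y).deriv

theorem hasDerivAt_pd1 {f : ℝ → ℝ → ℂ} {n : WithTop ℕ∞} (hf : ContDiff ℝ n (uncurry f))
    (hn : n ≠ 0) (x y : ℝ) : HasDerivAt (fun x' => f x' y) (pd1 f x y) x :=
  pd1_eq_fderiv hf hn x y ▸ hasDerivAt_fst_fderiv hf hn x y

theorem hasDerivAt_pd2 {f : ℝ → ℝ → ℂ} {n : WithTop ℕ∞} (hf : ContDiff ℝ n (uncurry f))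
    (hn : n ≠ 0) (x y : ℝ) : HasDerivAt (fun y' => f x y') (pd2 f x y) y :=
  pd2_eq_fderiv hf hn x y ▸ hasDerivAt_snd_fderiv hf hn x y

theorem hasDerivAt_diag {f : ℝ → ℝ → ℂ} {n : WithTop ℕ∞} (hf : ContDiff ℝ n (uncurry f))
    (hn : n ≠ 0) (x : ℝ) : HasDerivAt (fun s => f s s) (pd1 f x x + pd2 f x x) x := by
  rw [pd1_eq_fderiv hf hn, pd2_eq_fderiv hf hn, ← map_add]
  simpa using! (hasFDerivAt_uncurry hf hn x x).comp_hasDerivAt (f := fun s => (s, s)) x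
    ((hasDerivAt_id x).prodMk (hasDerivAt_id x))

theorem contDiff_pd1 {f : ℝ → ℝ → ℂ} {n m : WithTop ℕ∞} (hf : ContDiff ℝ n (uncurry f))
    (hmn : m + 1 ≤ n) : ContDiff ℝ m (uncurry (pd1 f)) := by
  have hn : n ≠ 0 := by
    rintro rfl
    simp at hmn
  have h : uncurry (pd1 f) = fun q => fderiv ℝ (uncurry f) q (1, 0) :=
    funext fun q => pd1_eq_fderiv hf hn q.1 q.2
  rw [h]
  exact (hf.fderiv_right hmn).clm_apply contDiff_const

theorem contDiff_pd2 {f : ℝ → ℝ → ℂ} {n m : WithTop ℕ∞} (hf : ContDiff ℝ n (uncurry f))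
    (hmn : m + 1 ≤ n) : ContDiff ℝ m (uncurry (pd2 f)) := by
  have hn : n ≠ 0 := by
    rintro rfl
    simp at hmn
  have h : uncurry (pd2 f) = fun q => fderiv ℝ (uncurry f) q (0, 1) :=
    funext fun q => pd2_eq_fderiv hf hn q.1 q.2
  rw [h]
  exact (hf.fderiv_right hmn).clm_apply contDiff_const

theorem pd1_pd2_comm {f : ℝ → ℝ → ℂ} (hf : ContDiff ℝ 2 (uncurry f)) (x y : ℝ) :
    pd1 (pd2 f) x y = pd2 (pd1 f) x y := by
  have hF : HasFDerivAt (fderiv ℝ (uncurry f)) (fderiv ℝ (fderiv ℝ (uncurry f)) (x, y)) (x, y) :=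
    (((hf.fderiv_right (m := 1) (by norm_num)).differentiable one_ne_zero) (x, y)).hasFDerivAt
  have h1 : HasDerivAt (fun x' => pd2 f x' y)
      (fderiv ℝ (fderiv ℝ (uncurry f)) (x, y) (1, 0) (0, 1)) x := by
    simp only [pd2_eq_fderiv hf two_ne_zero]
    exact ((ContinuousLinearMap.apply ℝ ℂ ((0, 1) : ℝ × ℝ)).hasFDerivAt.comp _ hF).comp_hasDerivAt
      (f := fun s => (s, y)) x ((hasDerivAt_id x).prodMk (hasDerivAt_const x y))
  have h2 : HasDerivAt (fun y' => pd1 f x y')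
      (fderiv ℝ (fderiv ℝ (uncurry f)) (x, y) (0, 1) (1, 0)) y := by
    simp only [pd1_eq_fderiv hf two_ne_zero]
    exact ((ContinuousLinearMap.apply ℝ ℂ ((1, 0) : ℝ × ℝ)).hasFDerivAt.comp _ hF).comp_hasDerivAt
      (f := fun s => (x, s)) y ((hasDerivAt_const y x).prodMk (hasDerivAt_id y))
  rw [pd1, pd2, h1.deriv, h2.deriv]
  exact hf.contDiffAt.isSymmSndFDerivAt (by simp) (1, 0) (0, 1)

theorem pd1_congr {f g : ℝ → ℝ → ℂ} {q : ℝ × ℝ} (h : uncurry f =ᶠ[𝓝 q] uncurry g) :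
    uncurry (pd1 f) =ᶠ[𝓝 q] uncurry (pd1 g) := by
  filter_upwards [h.eventuallyEq_nhds] with z hz
  have hc : Tendsto (fun x' : ℝ => (x', z.2)) (𝓝 z.1) (𝓝 z) := by
    have : Continuous fun x' : ℝ => (x', z.2) := by fun_prop
    exact this.tendsto z.1
  exact EventuallyEq.deriv_eq (hc.eventually hz)

theorem pd2_congr {f g : ℝ → ℝ → ℂ} {q : ℝ × ℝ} (h : uncurry f =ᶠ[𝓝 q] uncurry g) :
    uncurry (pd2 f) =ᶠ[𝓝 q] uncurry (pd2 g) := by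
  filter_upwards [h.eventuallyEq_nhds] with z hz
  have hc : Tendsto (fun y' : ℝ => (z.1, y')) (𝓝 z.2) (𝓝 z) := by
    have : Continuous fun y' : ℝ => (z.1, y') := by fun_prop
    exact this.tendsto z.2
  exact EventuallyEq.deriv_eq (hc.eventually hz)

theorem hasDerivAt_integral_of_continuous {f f' : ℝ → ℝ → ℂ} (hf : Continuous (uncurry f))
    (hf' : Continuous (uncurry f')) (h : ∀ x y, HasDerivAt (fun x' => f x' y) (f' x y) x)
    (a b x : ℝ) :
    HasDerivAt (fun x' => ∫ y in a..b, f x' y) (∫ y in a..b, f' x y) x := by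
  obtain ⟨C, hC⟩ := ((isCompact_closedBall x 1).prod (isCompact_uIcc (a := a) (b := b))
    ).exists_bound_of_continuousOn hf'.continuousOn
  have hcf : ∀ x', Continuous (f x') := fun x' => hf.comp (Continuous.prodMk_right x')
  have hcf' : ∀ x', Continuous (f' x') := fun x' => hf'.comp (Continuous.prodMk_right x')
  refine (intervalIntegral.hasDerivAt_integral_of_dominated_loc_of_deriv_le
    (s := Metric.closedBall x 1) (bound := fun _ => C) (F' := f')
    (Metric.closedBall_mem_nhds x one_pos)
    (Eventually.of_forall fun x' => (hcf x').aestronglyMeasurable)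
    ((hcf x).intervalIntegrable a b) (hcf' x).aestronglyMeasurable ?_
    intervalIntegrable_const ?_).2
  · exact Eventually.of_forall fun y hy x' hx' => hC (x', y) ⟨hx', uIoc_subset_uIcc hy⟩
  · exact Eventually.of_forall fun y _ x' _ => h x' y

theorem hasDerivAt_integral_right_endpoint {f f' : ℝ → ℝ → ℂ} (hf : Continuous (uncurry f))
    (hf' : Continuous (uncurry f')) (h : ∀ x y, HasDerivAt (fun x' => f x' y) (f' x y) x)
    (a x : ℝ) :
    HasDerivAt (fun x' => ∫ y in a..x', f x' y) (f x x + ∫ y in a..x, f' x y) x := by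
  have hcf : ∀ x', Continuous (f x') := fun x' => hf.comp (Continuous.prodMk_right x')
  let G : ℝ → ℝ → ℂ := fun s b => ∫ y in a..b, f s y
  let G₁ : ℝ → ℝ → ℝ →L[ℝ] ℂ := fun s b =>
    ContinuousLinearMap.toSpanSingleton ℝ (∫ y in a..b, f' s y)
  let G₂ : ℝ → ℝ → ℝ →L[ℝ] ℂ := fun s b => ContinuousLinearMap.toSpanSingleton ℝ (f s b)
  have hspan : Continuous fun z : ℂ => ContinuousLinearMap.toSpanSingleton ℝ z :=
    (ContinuousLinearMap.toSpanSingletonCLE (𝕜 := ℝ) (E := ℂ)).continuous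
  have hG : HasStrictFDerivAt (uncurry G) ((G₁ x x).coprod (G₂ x x)) (x, x) :=
    hasStrictFDerivAt_uncurry_coprod (u := (x, x)) (f := G) (f₁ := G₁) (f₂ := G₂)
      (Eventually.of_forall fun z =>
        (hasDerivAt_integral_of_continuous hf hf' h a z.2 z.1).hasFDerivAt)
      (Eventually.of_forall fun z =>
        ((hcf z.1).integral_hasStrictDerivAt a z.2).hasDerivAt.hasFDerivAt)
      (hspan.comp (intervalIntegral.continuous_parametric_primitive_of_continuous
        (a₀ := a) hf')).continuousAt
      (hspan.comp hf).continuousAt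
  have := hG.hasFDerivAt.comp_hasDerivAt (f := fun s => (s, s)) x
    ((hasDerivAt_id x).prodMk (hasDerivAt_id x))
  simpa [G, G₁, G₂, Function.comp_def, add_comm] using! this

/-- Differentiation of a Volterra integral with `C¹` kernel. -/
theorem hasDerivAt_volterra {K : ℝ → ℝ → ℂ} {n : WithTop ℕ∞} (hK : ContDiff ℝ n (uncurry K))
    (hn : 1 ≤ n) {v : ℝ → ℂ} (hv : Continuous v) (x : ℝ) :
    HasDerivAt (fun s => ∫ y in (0:ℝ)..s, K s y * v y)
      (K x x * v x + ∫ y in (0:ℝ)..x, pd1 K x y * v y) x := by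
  have hn0 : n ≠ 0 := (zero_lt_one.trans_le hn).ne'
  have h1 : Continuous (uncurry (pd1 K)) := (contDiff_pd1 (m := 0) hK (by simpa using hn)).continuous
  exact hasDerivAt_integral_right_endpoint (f := fun s y => K s y * v y)
    (f' := fun s y => pd1 K s y * v y)
    (hK.continuous.mul (hv.comp continuous_snd)) (h1.mul (hv.comp continuous_snd))
    (fun s y => (hasDerivAt_pd1 hK hn0 s y).mul_const (v y)) 0 x

theorem integral_mul_pd1_eq {f g : ℝ → ℝ → ℂ} (hf : ContDiff ℝ 1 (uncurry f))
    (hg : ContDiff ℝ 1 (uncurry g)) (x t : ℝ) :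
    ∫ y in (0:ℝ)..x, f x y * pd1 g y t =
      f x x * g x t - f x 0 * g 0 t - ∫ y in (0:ℝ)..x, pd2 f x y * g y t := by
  have h2 : Continuous (uncurry (pd2 f)) := (contDiff_pd2 (m := 0) hf (by simp)).continuous
  have h1 : Continuous (uncurry (pd1 g)) := (contDiff_pd1 (m := 0) hg (by simp)).continuous
  exact intervalIntegral.integral_mul_deriv_eq_deriv_mul
    (fun y _ => hasDerivAt_pd2 hf one_ne_zero x y) (fun y _ => hasDerivAt_pd1 hg one_ne_zero y t)
    ((h2.comp (Continuous.prodMk_right x)).intervalIntegrable 0 x)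
    ((h1.comp (Continuous.prodMk_left t)).intervalIntegrable 0 x)

theorem HasDerivAt.unique_of_eqOn_Icc {f g : ℝ → ℂ} {f' g' : ℂ} {a b x : ℝ} (hab : a < b)
    (hx : x ∈ Icc a b) (hfg : EqOn f g (Icc a b)) (hf : HasDerivAt f f' x)
    (hg : HasDerivAt g g' x) : f' = g' :=
  (uniqueDiffOn_Icc hab x hx).eq_deriv _ hf.hasDerivWithinAt
    (hg.hasDerivWithinAt.congr hfg (hfg hx))

/-- A function that is `C^n` near a closed set agrees near it with a globally `C^n` function. -/
theorem exists_contDiff_eventuallyEq_nhdsSet {f : ℝ × ℝ → ℂ} {n : ℕ∞} {S U : Set (ℝ × ℝ)}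
    (hS : IsClosed S) (hU : IsOpen U) (hSU : S ⊆ U) (hf : ContDiffOn ℝ n f U) :
    ∃ g : ℝ × ℝ → ℂ, ContDiff ℝ n g ∧ ∀ᶠ q in 𝓝ˢ S, g q = f q := by
  obtain ⟨W, hW, hSW, hWU⟩ := normal_exists_closure_subset hS hU hSU
  obtain ⟨χ, hχ1, hχ0, -⟩ := exists_contMDiffMap_one_nhds_of_subset_interior (n := n)
    (modelWithCornersSelf ℝ (ℝ × ℝ)) hS (t := W) (by rwa [hW.interior_eq])
  have hχ : ContDiff ℝ n χ := χ.contMDiff.contDiff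
  refine ⟨fun q => (χ q : ℂ) * f q, contDiff_iff_contDiffAt.2 fun q => ?_, ?_⟩
  · by_cases hq : q ∈ U
    · exact (Complex.ofRealCLM.contDiff.comp hχ).contDiffAt.mul (hf.contDiffAt (hU.mem_nhds hq))
    · have hz : (fun q => (χ q : ℂ) * f q) =ᶠ[𝓝 q] fun _ => 0 := by
        filter_upwards [isClosed_closure.isOpen_compl.mem_nhds
          (show q ∈ (closure W)ᶜ from fun h => hq (hWU h))] with z hz
        rw [hχ0 z fun h => hz (subset_closure h)]
        simp
      exact contDiffAt_const.congr_of_eventuallyEq hz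
  · filter_upwards [hχ1] with q hq
    simp [hq]

section Transform

variable {p w : ℝ → ℝ → ℂ}

theorem pd1_transform (hp : ContDiff ℝ 1 (uncurry p)) (hw : ContDiff ℝ 1 (uncurry w)) (x t : ℝ) :
    pd1 (fun x t => w x t - ∫ y in (0:ℝ)..x, p x y * w y t) x t =
      pd1 w x t - (p x x * w x t + ∫ y in (0:ℝ)..x, pd1 p x y * w y t) :=
  ((hasDerivAt_pd1 hw one_ne_zero x t).sub (hasDerivAt_volterra hp le_rfl
    (hw.continuous.comp (Continuous.prodMk_left t)) x)).deriv

theorem pd1_pd1_transform (hp : ContDiff ℝ 2 (uncurry p)) (hw : ContDiff ℝ 2 (uncurry w))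
    (x t : ℝ) :
    pd1 (pd1 (fun x t => w x t - ∫ y in (0:ℝ)..x, p x y * w y t)) x t =
      pd1 (pd1 w) x t - ((pd1 p x x + pd2 p x x) * w x t + p x x * pd1 w x t
        + (pd1 p x x * w x t + ∫ y in (0:ℝ)..x, pd1 (pd1 p) x y * w y t)) := by
  have h1 := funext₂ (pd1_transform (hp.of_le one_le_two) (hw.of_le one_le_two))
  rw [h1]
  exact ((hasDerivAt_pd1 (contDiff_pd1 (m := 1) hw (by norm_num)) one_ne_zero x t).sub
    (((hasDerivAt_diag hp two_ne_zero x).mul (hasDerivAt_pd1 hw two_ne_zero x t)).add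
      (hasDerivAt_volterra (contDiff_pd1 (m := 1) hp (by norm_num)) le_rfl
        (hw.continuous.comp (Continuous.prodMk_left t)) x))).deriv

theorem pd1_pd1_pd1_transform (hp : ContDiff ℝ 3 (uncurry p)) (hw : ContDiff ℝ 3 (uncurry w))
    (x t : ℝ) :
    pd1 (pd1 (pd1 (fun x t => w x t - ∫ y in (0:ℝ)..x, p x y * w y t))) x t =
      pd1 (pd1 (pd1 w)) x t -
        (((pd1 (pd1 p) x x + pd2 (pd1 p) x x + (pd1 (pd2 p) x x + pd2 (pd2 p) x x)) * w x t
            + (pd1 p x x + pd2 p x x) * pd1 w x t)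
          + ((pd1 p x x + pd2 p x x) * pd1 w x t + p x x * pd1 (pd1 w) x t)
          + (((pd1 (pd1 p) x x + pd2 (pd1 p) x x) * w x t + pd1 p x x * pd1 w x t)
            + (pd1 (pd1 p) x x * w x t + ∫ y in (0:ℝ)..x, pd1 (pd1 (pd1 p)) x y * w y t))) := by
  have h2 := funext₂ (pd1_pd1_transform (hp.of_le (by norm_num)) (hw.of_le (by norm_num)))
  rw [h2]
  have hp1 : ContDiff ℝ 2 (uncurry (pd1 p)) := contDiff_pd1 hp (by norm_num)
  have hp2 : ContDiff ℝ 2 (uncurry (pd2 p)) := contDiff_pd2 hp (by norm_num)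
  have hp11 : ContDiff ℝ 1 (uncurry (pd1 (pd1 p))) := contDiff_pd1 hp1 (by norm_num)
  have hw1 : ContDiff ℝ 2 (uncurry (pd1 w)) := contDiff_pd1 hw (by norm_num)
  have hw11 : ContDiff ℝ 1 (uncurry (pd1 (pd1 w))) := contDiff_pd1 hw1 (by norm_num)
  have hdw := hasDerivAt_pd1 hw three_ne_zero x t
  exact ((hasDerivAt_pd1 hw11 one_ne_zero x t).sub
    (((((hasDerivAt_diag hp1 two_ne_zero x).add (hasDerivAt_diag hp2 two_ne_zero x)).mul hdw).add
      ((hasDerivAt_diag hp three_ne_zero x).mul (hasDerivAt_pd1 hw1 two_ne_zero x t))).add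
      (((hasDerivAt_diag hp1 two_ne_zero x).mul hdw).add
        (hasDerivAt_volterra hp11 le_rfl
          (hw.continuous.comp (Continuous.prodMk_left t)) x)))).deriv

theorem pd2_transform (hp : Continuous (uncurry p)) (hw : ContDiff ℝ 1 (uncurry w)) (x t : ℝ) :
    pd2 (fun x t => w x t - ∫ y in (0:ℝ)..x, p x y * w y t) x t =
      pd2 w x t - ∫ y in (0:ℝ)..x, p x y * pd2 w y t := by
  have hpc : Continuous fun q : ℝ × ℝ => p x q.2 :=
    hp.comp (by fun_prop : Continuous fun q : ℝ × ℝ => (x, q.2))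
  have hw2 : Continuous (uncurry (pd2 w)) := (contDiff_pd2 (m := 0) hw (by simp)).continuous
  exact ((hasDerivAt_pd2 hw one_ne_zero x t).sub (hasDerivAt_integral_of_continuous
    (f := fun t y => p x y * w y t) (f' := fun t y => p x y * pd2 w y t)
    (hpc.mul (hw.continuous.comp continuous_swap)) (hpc.mul (hw2.comp continuous_swap))
    (fun s y => (hasDerivAt_pd2 hw one_ne_zero y s).const_mul (p x y)) 0 x t)).deriv

end Transform

theorem observer_transform_pde {β α δ r L T : ℝ} (hβ : 0 < β) (hL : 0 < L) (hT : 0 < T)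
    {p w : ℝ → ℝ → ℂ} (hpC : ContDiff ℝ 3 (uncurry p)) (hp : IsObsKernel β α δ r L p)
    (hw : ContDiff ℝ 3 (uncurry w))
    (hpde : ∀ x ∈ Ioo (0:ℝ) L, ∀ t ∈ Ioo (0:ℝ) T,
      Complex.I * pd2 w x t + Complex.I * (β : ℂ) * pd1 (pd1 (pd1 w)) x t
        + (α : ℂ) * pd1 (pd1 w) x t + Complex.I * (δ : ℂ) * pd1 w x t
        + Complex.I * (r : ℂ) * w x t = 0)
    (hbc0 : ∀ t ∈ Icc (0:ℝ) T, w 0 t = 0)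
    {u : ℝ → ℝ → ℂ} (hu : u = fun x t => w x t - ∫ y in (0:ℝ)..x, p x y * w y t) :
    (∀ x ∈ Icc (0:ℝ) L, ∀ t ∈ Icc (0:ℝ) T,
      Complex.I * pd2 u x t + Complex.I * (β : ℂ) * pd1 (pd1 (pd1 u)) x t
        + (α : ℂ) * pd1 (pd1 u) x t + Complex.I * (δ : ℂ) * pd1 u x t
        + (-Complex.I * (β : ℂ) * pd2 p x 0 + (α : ℂ) * p x 0) * pd1 u 0 t
        + (Complex.I * (β : ℂ) * p x 0) * pd1 (pd1 u) 0 t = 0) ∧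
    (∀ t ∈ Icc (0:ℝ) T,
      u 0 t = 0 ∧ pd1 u 0 t = pd1 w 0 t ∧ pd1 (pd1 u) 0 t = pd1 (pd1 w) 0 t ∧
      u L t = w L t) := by
  obtain ⟨-, hker, hdiag, hright, hdiag1⟩ := hp
  have hp1 : ContDiff ℝ 2 (uncurry (pd1 p)) := contDiff_pd1 hpC (by norm_num)
  have hp2 : ContDiff ℝ 2 (uncurry (pd2 p)) := contDiff_pd2 hpC (by norm_num)
  have hp11 : ContDiff ℝ 1 (uncurry (pd1 (pd1 p))) := contDiff_pd1 hp1 (by norm_num)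
  have hp22 : ContDiff ℝ 1 (uncurry (pd2 (pd2 p))) := contDiff_pd2 hp2 (by norm_num)
  have hp111 : ContDiff ℝ 0 (uncurry (pd1 (pd1 (pd1 p)))) := contDiff_pd1 hp11 (by simp)
  have hp222 : ContDiff ℝ 0 (uncurry (pd2 (pd2 (pd2 p)))) := contDiff_pd2 hp22 (by simp)
  have hw1 : ContDiff ℝ 2 (uncurry (pd1 w)) := contDiff_pd1 hw (by norm_num)
  have hwt : ContDiff ℝ 2 (uncurry (pd2 w)) := contDiff_pd2 hw (by norm_num)
  have hw11 : ContDiff ℝ 1 (uncurry (pd1 (pd1 w))) := contDiff_pd1 hw1 (by norm_num)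
  have hw111 : ContDiff ℝ 0 (uncurry (pd1 (pd1 (pd1 w)))) := contDiff_pd1 hw11 (by simp)
  have hu1 := pd1_transform (hpC.of_le (by norm_num)) (hw.of_le (by norm_num))
  have hu2 := pd1_pd1_transform (hpC.of_le (by norm_num)) (hw.of_le (by norm_num))
  have hu3 := pd1_pd1_pd1_transform hpC hw
  have hut := pd2_transform hpC.continuous (hw.of_le (by norm_num))
  rw [← hu] at hu1 hu2 hu3 hut
  have h0L : (0:ℝ) ∈ Icc (0:ℝ) L := ⟨le_rfl, hL.le⟩
  -- the transform at the two endpoints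
  have hends : ∀ t ∈ Icc (0:ℝ) T,
      u 0 t = 0 ∧ pd1 u 0 t = pd1 w 0 t ∧ pd1 (pd1 u) 0 t = pd1 (pd1 w) 0 t ∧
      u L t = w L t := by
    intro t ht
    refine ⟨by simp [hu, hbc0 t ht], by simp [hu1, hbc0 t ht],
      by simp [hu2, hbc0 t ht, hdiag 0 h0L], ?_⟩
    have hInt : ∫ y in (0:ℝ)..L, p L y * w y t = ∫ _ in (0:ℝ)..L, (0 : ℂ) :=
      intervalIntegral.integral_congr fun y hy => by
        rw [uIcc_of_le hL.le] at hy
        simp [hright y hy]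
    simp [hu, hInt]
  refine ⟨fun x hx t ht => ?_, hends⟩
  -- the derivatives of the kernel on the diagonal
  have hd1 : ∀ s ∈ Icc (0:ℝ) L, pd1 p s s + pd2 p s s = 0 := fun s hs =>
    HasDerivAt.unique_of_eqOn_Icc (g := fun _ => 0) hL hs hdiag
      (hasDerivAt_diag hpC three_ne_zero s) (hasDerivAt_const s 0)
  have hd2 : pd1 (pd1 p) x x + pd2 (pd1 p) x x + (pd1 (pd2 p) x x + pd2 (pd2 p) x x) = 0 :=
    HasDerivAt.unique_of_eqOn_Icc (g := fun _ => 0) hL hx hd1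
      ((hasDerivAt_diag hp1 two_ne_zero x).add (hasDerivAt_diag hp2 two_ne_zero x))
      (hasDerivAt_const x 0)
  have hd11 : pd1 (pd1 p) x x + pd2 (pd1 p) x x = ((r * (-1) / (3 * β) : ℝ) : ℂ) :=
    HasDerivAt.unique_of_eqOn_Icc hL hx hdiag1 (hasDerivAt_diag hp1 two_ne_zero x)
      ((((hasDerivAt_id x).const_sub L).const_mul r).div_const (3 * β)).ofReal_comp
  have hcomm := pd1_pd2_comm (hpC.of_le (by norm_num)) x x
  have hβr : (β : ℂ) * ((r * (-1) / (3 * β) : ℝ) : ℂ) = -(r : ℂ) / 3 := by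
    have : (β : ℂ) ≠ 0 := by exact_mod_cast hβ.ne'
    push_cast
    field_simp
  -- the equation for `w` holds up to the boundary
  have hpde' : ∀ q ∈ Icc (0:ℝ) L ×ˢ Icc (0:ℝ) T,
      Complex.I * pd2 w q.1 q.2 + Complex.I * (β : ℂ) * pd1 (pd1 (pd1 w)) q.1 q.2
        + (α : ℂ) * pd1 (pd1 w) q.1 q.2 + Complex.I * (δ : ℂ) * pd1 w q.1 q.2
        + Complex.I * (r : ℂ) * w q.1 q.2 = 0 := by
    rw [← closure_Ioo hL.ne, ← closure_Ioo hT.ne, ← closure_prod_eq]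
    refine EqOn.closure (f := fun q : ℝ × ℝ => Complex.I * pd2 w q.1 q.2
        + Complex.I * (β : ℂ) * pd1 (pd1 (pd1 w)) q.1 q.2
        + (α : ℂ) * pd1 (pd1 w) q.1 q.2 + Complex.I * (δ : ℂ) * pd1 w q.1 q.2
        + Complex.I * (r : ℂ) * w q.1 q.2) (g := fun _ => 0)
      (fun q hq => hpde q.1 hq.1 q.2 hq.2) ?_ continuous_const
    exact ((((continuous_const.mul hwt.continuous).add
      (continuous_const.mul hw111.continuous)).add (continuous_const.mul hw11.continuous)).add
      (continuous_const.mul hw1.continuous)).add (continuous_const.mul hw.continuous)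
  have hInt : ∀ {K v : ℝ → ℝ → ℂ}, Continuous (uncurry K) → Continuous (uncurry v) →
      IntervalIntegrable (fun y => K x y * v y t) volume 0 x := fun hK hv =>
    ((hK.comp (Continuous.prodMk_right x)).mul
      (hv.comp (Continuous.prodMk_left t))).intervalIntegrable 0 x
  have hIw : Complex.I * (∫ y in (0:ℝ)..x, p x y * pd2 w y t)
      + Complex.I * (β : ℂ) * (∫ y in (0:ℝ)..x, p x y * pd1 (pd1 (pd1 w)) y t)
      + (α : ℂ) * (∫ y in (0:ℝ)..x, p x y * pd1 (pd1 w) y t)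
      + Complex.I * (δ : ℂ) * (∫ y in (0:ℝ)..x, p x y * pd1 w y t)
      + Complex.I * (r : ℂ) * (∫ y in (0:ℝ)..x, p x y * w y t) = 0 := by
    have i1 := hInt hpC.continuous hwt.continuous
    have i2 := hInt hpC.continuous hw111.continuous
    have i3 := hInt hpC.continuous hw11.continuous
    have i4 := hInt hpC.continuous hw1.continuous
    have i5 := hInt hpC.continuous hw.continuous
    simp only [← intervalIntegral.integral_const_mul]
    rw [← intervalIntegral.integral_add (i1.const_mul _) (i2.const_mul _),
      ← intervalIntegral.integral_add ((i1.const_mul _).add (i2.const_mul _)) (i3.const_mul _),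
      ← intervalIntegral.integral_add
        (((i1.const_mul _).add (i2.const_mul _)).add (i3.const_mul _)) (i4.const_mul _),
      ← intervalIntegral.integral_add
        ((((i1.const_mul _).add (i2.const_mul _)).add (i3.const_mul _)).add (i4.const_mul _))
        (i5.const_mul _)]
    refine (intervalIntegral.integral_congr (g := fun _ => (0 : ℂ)) fun y hy => ?_).trans
      intervalIntegral.integral_zero
    rw [uIcc_of_le hx.1] at hy
    have := hpde' (y, t) ⟨⟨hy.1, hy.2.trans hx.2⟩, ht⟩
    linear_combination p x y * this
  have hIp : (β : ℂ) * (∫ y in (0:ℝ)..x, pd1 (pd1 (pd1 p)) x y * w y t)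
      + (β : ℂ) * (∫ y in (0:ℝ)..x, pd2 (pd2 (pd2 p)) x y * w y t)
      + (-Complex.I * α) * (∫ y in (0:ℝ)..x, pd1 (pd1 p) x y * w y t)
      + (Complex.I * α) * (∫ y in (0:ℝ)..x, pd2 (pd2 p) x y * w y t)
      + (δ : ℂ) * (∫ y in (0:ℝ)..x, pd1 p x y * w y t)
      + (δ : ℂ) * (∫ y in (0:ℝ)..x, pd2 p x y * w y t)
      + (-r : ℂ) * (∫ y in (0:ℝ)..x, p x y * w y t) = 0 := by
    have i1 := (hInt hp111.continuous hw.continuous).const_mul (β : ℂ)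
    have i2 := i1.add ((hInt hp222.continuous hw.continuous).const_mul (β : ℂ))
    have i3 := i2.add ((hInt hp11.continuous hw.continuous).const_mul (-Complex.I * α))
    have i4 := i3.add ((hInt hp22.continuous hw.continuous).const_mul (Complex.I * α))
    have i5 := i4.add ((hInt hp1.continuous hw.continuous).const_mul (δ : ℂ))
    have i6 := i5.add ((hInt hp2.continuous hw.continuous).const_mul (δ : ℂ))
    simp only [← intervalIntegral.integral_const_mul]
    rw [← intervalIntegral.integral_add i1
        ((hInt hp222.continuous hw.continuous).const_mul _),
      ← intervalIntegral.integral_add i2 ((hInt hp11.continuous hw.continuous).const_mul _),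
      ← intervalIntegral.integral_add i3 ((hInt hp22.continuous hw.continuous).const_mul _),
      ← intervalIntegral.integral_add i4 ((hInt hp1.continuous hw.continuous).const_mul _),
      ← intervalIntegral.integral_add i5 ((hInt hp2.continuous hw.continuous).const_mul _),
      ← intervalIntegral.integral_add i6 ((hInt hpC.continuous hw.continuous).const_mul _)]
    refine (intervalIntegral.integral_congr (g := fun _ => (0 : ℂ)) fun y hy => ?_).trans
      intervalIntegral.integral_zero
    rw [uIcc_of_le hx.1] at hy
    have := hker (x, y) ⟨hy.1, hy.2, hx.2⟩
    linear_combination w y t * this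
  have hparts1 := integral_mul_pd1_eq (hpC.of_le (by norm_num)) (hw.of_le (by norm_num)) x t
  have hparts2 := integral_mul_pd1_eq (hpC.of_le (by norm_num)) (hw1.of_le (by norm_num)) x t
  have hparts2' := integral_mul_pd1_eq (hp2.of_le (by norm_num)) (hw.of_le (by norm_num)) x t
  have hparts3 := integral_mul_pd1_eq (hpC.of_le (by norm_num)) hw11 x t
  have hparts3' := integral_mul_pd1_eq (hp2.of_le (by norm_num)) (hw1.of_le (by norm_num)) x t
  have hparts3'' := integral_mul_pd1_eq hp22 (hw.of_le (by norm_num)) x t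
  rw [(hends t ht).2.1, (hends t ht).2.2.1, hut, hu1, hu2, hu3]
  rw [hparts3, hparts2, hparts1, hparts3', hparts2', hparts3'', hbc0 t ht, hdiag x hx] at hIw
  rw [hdiag x hx, hd2, hd1 x hx, hd11]
  have hpdex := hpde' (x, t) ⟨hx, ht⟩
  have hd1x := hd1 x hx
  rw [hcomm] at hd2
  simp only at hpdex
  linear_combination hpdex - hIw - Complex.I * hIp + Complex.I * β * w x t * (hd2 - 2 * hd11)
    - 3 * Complex.I * w x t * hβr - (Complex.I * β * pd1 w x t + α * w x t) * hd1x
    + α * ((∫ y in (0:ℝ)..x, pd2 (pd2 p) x y * w y t)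
      - ∫ y in (0:ℝ)..x, pd1 (pd1 p) x y * w y t) * Complex.I_sq

theorem isCompact_Tri (L : ℝ) : IsCompact (Tri L) := by
  refine (isCompact_Icc.prod isCompact_Icc).of_isClosed_subset (s := Icc (0:ℝ) L ×ˢ Icc (0:ℝ) L)
    ?_ fun q hq => ⟨⟨hq.1.trans hq.2.1, hq.2.2⟩, ⟨hq.1, hq.2.1.trans hq.2.2⟩⟩
  exact (isClosed_le continuous_const continuous_snd).inter
    ((isClosed_le continuous_snd continuous_fst).inter
      (isClosed_le continuous_fst continuous_const))

theorem IsObsKernel.congr {β α δ r L : ℝ} {p p' : ℝ → ℝ → ℂ} (hp : IsObsKernel β α δ r L p)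
    (hC : ContDiff ℝ 3 (uncurry p')) (h : ∀ q ∈ Tri L, uncurry p' =ᶠ[𝓝 q] uncurry p) :
    IsObsKernel β α δ r L p' := by
  obtain ⟨-, hker, hdiag, hright, hdiag1⟩ := hp
  refine ⟨⟨univ, isOpen_univ, subset_univ _, hC.contDiffOn⟩, fun q hq => ?_, fun x hx => ?_,
    fun y hy => ?_, fun x hx => ?_⟩
  · have e0 : p' q.1 q.2 = p q.1 q.2 := (h q hq).eq_of_nhds
    have e1 := pd1_congr (h q hq)
    have e2 := pd2_congr (h q hq)
    have e11 := pd1_congr e1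
    have e22 := pd2_congr e2
    have v1 : pd1 p' q.1 q.2 = pd1 p q.1 q.2 := e1.eq_of_nhds
    have v2 : pd2 p' q.1 q.2 = pd2 p q.1 q.2 := e2.eq_of_nhds
    have v11 : pd1 (pd1 p') q.1 q.2 = pd1 (pd1 p) q.1 q.2 := e11.eq_of_nhds
    have v22 : pd2 (pd2 p') q.1 q.2 = pd2 (pd2 p) q.1 q.2 := e22.eq_of_nhds
    have v111 : pd1 (pd1 (pd1 p')) q.1 q.2 = pd1 (pd1 (pd1 p)) q.1 q.2 :=
      (pd1_congr e11).eq_of_nhds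
    have v222 : pd2 (pd2 (pd2 p')) q.1 q.2 = pd2 (pd2 (pd2 p)) q.1 q.2 :=
      (pd2_congr e22).eq_of_nhds
    rw [e0, v1, v2, v11, v22, v111, v222]
    exact hker q hq
  · exact (h (x, x) ⟨hx.1, le_rfl, hx.2⟩).eq_of_nhds.trans (hdiag x hx)
  · exact (h (L, y) ⟨hy.1, hy.2, le_rfl⟩).eq_of_nhds.trans (hright y hy)
  · exact (pd1_congr (h (x, x) ⟨hx.1, le_rfl, hx.2⟩)).eq_of_nhds.trans (hdiag1 x hx)

theorem eventually_forall_uIcc_eq {L : ℝ} {p p' : ℝ → ℝ → ℂ}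
    (h : ∀ q ∈ Tri L, uncurry p' =ᶠ[𝓝 q] uncurry p) {x : ℝ} (hx : x ∈ Icc (0:ℝ) L) :
    ∀ᶠ s in 𝓝 x, ∀ y ∈ uIcc 0 s, p' s y = p s y := by
  have hK : ∀ᶠ s in 𝓝 x, ∀ c ∈ Icc (0:ℝ) 1, p' s (c * s) = p s (c * s) := by
    refine isCompact_Icc.eventually_forall_of_forall_eventually fun c hc => ?_
    have hcont : Continuous fun z : ℝ × ℝ => (z.1, z.2 * z.1) := by fun_prop
    exact (hcont.tendsto (x, c)).eventually (h (x, c * x)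
      ⟨mul_nonneg hc.1 hx.1, mul_le_of_le_one_left hx.1 hc.2, hx.2⟩)
  filter_upwards [hK] with s hs y hy
  rw [← segment_eq_uIcc, segment_eq_image] at hy
  obtain ⟨c, hc, rfl⟩ := hy
  simpa using hs c hc

theorem stmt11 (β α δ r L T : ℝ) (hβ : 0 < β) (hL : 0 < L) (hT : 0 < T)
    (p : ℝ → ℝ → ℂ) (hp : IsObsKernel β α δ r L p)
    (w : ℝ → ℝ → ℂ) (hw : ContDiff ℝ (⊤ : ℕ∞) (Function.uncurry w))
    (hpde : ∀ x ∈ Set.Ioo (0:ℝ) L, ∀ t ∈ Set.Ioo (0:ℝ) T,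
      Complex.I * pd2 w x t + Complex.I * (β : ℂ) * pd1 (pd1 (pd1 w)) x t
        + (α : ℂ) * pd1 (pd1 w) x t + Complex.I * (δ : ℂ) * pd1 w x t
        + Complex.I * (r : ℂ) * w x t = 0)
    (hbc0 : ∀ t ∈ Set.Icc (0:ℝ) T, w 0 t = 0)
    (u : ℝ → ℝ → ℂ)
    (hudef : ∀ x t : ℝ, u x t = w x t - ∫ y in (0:ℝ)..x, p x y * w y t) :
    (∀ x ∈ Set.Icc (0:ℝ) L, ∀ t ∈ Set.Icc (0:ℝ) T,
      Complex.I * pd2 u x t + Complex.I * (β : ℂ) * pd1 (pd1 (pd1 u)) x t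
        + (α : ℂ) * pd1 (pd1 u) x t + Complex.I * (δ : ℂ) * pd1 u x t
        + (-Complex.I * (β : ℂ) * pd2 p x 0 + (α : ℂ) * p x 0) * pd1 u 0 t
        + (Complex.I * (β : ℂ) * p x 0) * pd1 (pd1 u) 0 t = 0) ∧
    (∀ t ∈ Set.Icc (0:ℝ) T,
      u 0 t = 0 ∧ pd1 u 0 t = pd1 w 0 t ∧ pd1 (pd1 u) 0 t = pd1 (pd1 w) 0 t ∧
      u L t = w L t) := by
  obtain ⟨U, hU, hTU, hpU⟩ := hp.1
  obtain ⟨g, hg, hgp⟩ := exists_contDiff_eventuallyEq_nhdsSet (n := 3)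
    (isCompact_Tri L).isClosed hU hTU hpU
  have hnear : ∀ q ∈ Tri L, uncurry (curry g) =ᶠ[𝓝 q] uncurry p := fun q hq => by
    rw [uncurry_curry]
    exact hgp.filter_mono (nhds_le_nhdsSet hq)
  have hgC : ContDiff ℝ 3 (uncurry (curry g)) := by simpa using hg
  obtain ⟨hmain, hends⟩ := observer_transform_pde hβ hL hT hgC (hp.congr hgC hnear)
    (by exact_mod_cast contDiff_infty.1 hw 3) hpde hbc0 rfl
  set v : ℝ → ℝ → ℂ := fun x t => w x t - ∫ y in (0:ℝ)..x, curry g x y * w y t with hv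
  have huv : ∀ x ∈ Icc (0:ℝ) L, ∀ t, uncurry u =ᶠ[𝓝 (x, t)] uncurry v := by
    intro x hx t
    filter_upwards [continuous_fst.continuousAt.eventually (eventually_forall_uIcc_eq hnear hx)]
      with z hz
    have hInt : ∫ y in (0:ℝ)..z.1, p z.1 y * w y z.2
        = ∫ y in (0:ℝ)..z.1, curry g z.1 y * w y z.2 :=
      intervalIntegral.integral_congr fun y hy => by simp only [hz y hy]
    simp only [uncurry, hudef, hv, hInt]
  have e0 : ∀ x ∈ Icc (0:ℝ) L, ∀ t, u x t = v x t := fun x hx t => (huv x hx t).eq_of_nhds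
  have et : ∀ x ∈ Icc (0:ℝ) L, ∀ t, pd2 u x t = pd2 v x t := fun x hx t =>
    (pd2_congr (huv x hx t)).eq_of_nhds
  have e1 : ∀ x ∈ Icc (0:ℝ) L, ∀ t, pd1 u x t = pd1 v x t := fun x hx t =>
    (pd1_congr (huv x hx t)).eq_of_nhds
  have e2 : ∀ x ∈ Icc (0:ℝ) L, ∀ t, pd1 (pd1 u) x t = pd1 (pd1 v) x t := fun x hx t =>
    (pd1_congr (pd1_congr (huv x hx t))).eq_of_nhds
  have e3 : ∀ x ∈ Icc (0:ℝ) L, ∀ t, pd1 (pd1 (pd1 u)) x t = pd1 (pd1 (pd1 v)) x t :=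
    fun x hx t => (pd1_congr (pd1_congr (pd1_congr (huv x hx t)))).eq_of_nhds
  have h0 : (0:ℝ) ∈ Icc (0:ℝ) L := ⟨le_rfl, hL.le⟩
  refine ⟨fun x hx t ht => ?_, fun t ht => ?_⟩
  · have hx0 : ((x, 0) : ℝ × ℝ) ∈ Tri L := ⟨le_rfl, hx.1, hx.2⟩
    have p0 : curry g x 0 = p x 0 := (hnear _ hx0).eq_of_nhds
    have p2 : pd2 (curry g) x 0 = pd2 p x 0 := (pd2_congr (hnear _ hx0)).eq_of_nhds
    rw [et x hx, e1 x hx, e2 x hx, e3 x hx, e1 0 h0, e2 0 h0, ← p0, ← p2]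
    exact hmain x hx t ht
  · rw [e0 0 h0, e1 0 h0, e2 0 h0, e0 L ⟨hL.le, le_rfl⟩]
    exact hends t ht
end
end
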